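/- Let Γ = {1, -1} be the subgroup of ℂˣ of order 2. Then the congruences conGen {(T⁹, 1)} and conGen {(T³, 1)} on M(Γ) are both Γ-congruences, they are distinct, and conGen {(T⁹, 1)} is contained in conGen {(T³, 1)}. (Consequently in the strong congruence space of the projective line over F_{1²} one of the corresponding points lies in the closure of the other, so the subspace of non-generic points is not T1; hence the bijection b_Γ of the main theorem is not a homeomorphism in general.) -/

import Mathlib

open Multiplicative

/-- The monomial pointed monoid `Γ[T]`, modeled as `WithZero (Γ × Multiplicative ℕ)`:
the nonzero element `(γ, k)` represents the monomial `γ·T^k`. -/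
abbrev MGamma (Γ : Subgroup ℂˣ) : Type := WithZero (Γ × Multiplicative ℕ)

/-- The element `T` of `Γ[T]`. -/
noncomputable def Tgen (Γ : Subgroup ℂˣ) : MGamma Γ := (((1 : Γ), ofAdd 1) : Γ × Multiplicative ℕ)

/-- The constant `γ ∈ Γ`, viewed as an element of `Γ[T]`. -/
noncomputable def constE {Γ : Subgroup ℂˣ} (γ : Γ) : MGamma Γ := ((γ, ofAdd 0) : Γ × Multiplicative ℕ)

/-- The congruence generated by the single pair `(a, b)`. -/
def conGenPair {M : Type*} [Mul M] (a b : M) : Con M := conGen (fun x y => x = a ∧ y = b)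

/-- A congruence `c` on `M` is a strong prime congruence if it is the congruence kernel of a
monoid-with-zero homomorphism from `M` to some field. -/
def IsStrongPrimeCon {M : Type*} [CommMonoidWithZero M] (c : Con M) : Prop :=
  ∃ (K : Type) (_ : Field K), ∃ f : M →*₀ K, Con.ker f.toMonoidHom = c

/-- A congruence `c` on `Γ[T]` is a `Γ`-congruence if it is a strong prime congruence and
distinct constants remain distinct modulo `c`. -/
def IsGammaCon (Γ : Subgroup ℂˣ) (c : Con (MGamma Γ)) : Prop :=
  IsStrongPrimeCon c ∧ ∀ γ δ : Γ, c (constE γ) (constE δ) → γ = δ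

/-- The evaluation map sending `γ·T^k` to `γ ζ^k`. -/
noncomputable def evalHom (Γ : Subgroup ℂˣ) (z : ℂ) : MGamma Γ →*₀ ℂ :=
  WithZero.lift' (MonoidHom.coprod ((Units.coeHom ℂ).comp Γ.subtype) (powersHom ℂ z))

theorem evalHom_coe (Γ : Subgroup ℂˣ) (z : ℂ) (g : Γ) (k : ℕ) :
    evalHom Γ z (((g, ofAdd k) : Γ × Multiplicative ℕ) : MGamma Γ) = ((g : ℂˣ) : ℂ) * z ^ k := by
  simp [evalHom]

theorem Tgen_pow (Γ : Subgroup ℂˣ) (n : ℕ) :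
    Tgen Γ ^ n = (((1 : Γ), ofAdd n) : Γ × Multiplicative ℕ) := by
  rw [Tgen, ← WithZero.coe_pow, Prod.pow_mk, one_pow, ← ofAdd_nsmul]
  simp

theorem constE_one (Γ : Subgroup ℂˣ) : (constE 1 : MGamma Γ) = 1 := rfl

theorem conGenPair_pow {M : Type*} [CommMonoid M] (t : M) (n q : ℕ) :
    conGenPair (t ^ n) 1 (t ^ (n * q)) 1 := by
  have h : conGenPair (t ^ n) 1 (t ^ n) 1 := ConGen.Rel.of _ _ ⟨rfl, rfl⟩
  have := (conGenPair (t ^ n) 1).pow q h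
  simpa [pow_mul] using this

theorem conGenPair_mod (Γ : Subgroup ℂˣ) (n a : ℕ) (g : Γ) :
    conGenPair (Tgen Γ ^ n) 1 (((g, ofAdd a) : Γ × Multiplicative ℕ) : MGamma Γ)
      (((g, ofAdd (a % n)) : Γ × Multiplicative ℕ) : MGamma Γ) := by
  have h := (conGenPair (Tgen Γ ^ n) 1).mul
    ((conGenPair (Tgen Γ ^ n) 1).refl (((g, ofAdd (a % n)) : Γ × Multiplicative ℕ) : MGamma Γ))
    (conGenPair_pow (Tgen Γ) n (a / n))
  rw [Tgen_pow Γ (n * (a / n)), ← WithZero.coe_mul, Prod.mk_mul_mk, mul_one, mul_one, ← ofAdd_add,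
    Nat.mod_add_div] at h
  exact h

theorem eval_eq (Γ : Subgroup ℂˣ) (hΓ : (Γ : Set ℂˣ) = {1, -1}) (n : ℕ) (hn : Odd n) (z : ℂ)
    (hz : IsPrimitiveRoot z n) (g h : Γ) (a b : ℕ)
    (e : ((g : ℂˣ) : ℂ) * z ^ a = ((h : ℂˣ) : ℂ) * z ^ b) : g = h ∧ a % n = b % n := by
  have sq : ∀ g : Γ, ((g : ℂˣ) : ℂ) ^ 2 = 1 := by
    intro g
    have hg : (g : ℂˣ) ∈ (Γ : Set ℂˣ) := g.2
    rw [hΓ] at hg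
    rcases hg with hg | hg
    · simp [hg]
    · rw [Set.mem_singleton_iff] at hg
      simp [hg]
  have e2 : z ^ (2 * a) = z ^ (2 * b) := by
    have := congrArg (· ^ 2) e
    simp only [mul_pow, sq, one_mul, ← pow_mul] at this
    rw [mul_comm 2 a, mul_comm 2 b]; exact this
  have hfo : IsOfFinOrder z :=
    isOfFinOrder_iff_pow_eq_one.2 ⟨n, hn.pos, hz.pow_eq_one⟩
  have hm : 2 * a ≡ 2 * b [MOD n] := by
    rw [hz.eq_orderOf]
    exact (hfo.pow_eq_pow_iff_modEq).1 e2
  have hab : a ≡ b [MOD n] :=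
    Nat.ModEq.cancel_left_of_coprime (by simpa using hn) hm
  refine ⟨?_, hab⟩
  have hzz : z ^ a = z ^ b := by
    rw [hz.eq_orderOf] at hab
    exact (hfo.pow_eq_pow_iff_modEq).2 hab
  have hz0 : z ≠ 0 := hz.ne_zero (by rintro rfl; simp at hn)
  rw [hzz] at e
  exact Subtype.ext (Units.ext (mul_right_cancel₀ (pow_ne_zero _ hz0) e))

theorem ker_eq (Γ : Subgroup ℂˣ) (hΓ : (Γ : Set ℂˣ) = {1, -1}) (n : ℕ) (hn : Odd n) (z : ℂ)
    (hz : IsPrimitiveRoot z n) :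
    Con.ker (evalHom Γ z).toMonoidHom = conGenPair (Tgen Γ ^ n) (constE 1) := by
  have hz0 : z ≠ 0 := hz.ne_zero (by rintro rfl; simp at hn)
  apply le_antisymm
  · intro x y hxy
    have hxy : evalHom Γ z x = evalHom Γ z y := hxy
    rw [constE_one]
    have ne : ∀ p : Γ × Multiplicative ℕ, evalHom Γ z (p : MGamma Γ) ≠ 0 := by
      rintro ⟨g, k⟩
      have := evalHom_coe Γ z g k.toAdd
      rw [ofAdd_toAdd] at this
      rw [this]
      exact mul_ne_zero (Units.ne_zero _) (pow_ne_zero _ hz0)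
    induction x using WithZero.recZeroCoe with
    | zero =>
      induction y using WithZero.recZeroCoe with
      | zero => exact Con.refl _ _
      | coe q => rw [map_zero] at hxy; exact absurd hxy.symm (ne q)
    | coe p =>
      induction y using WithZero.recZeroCoe with
      | zero => rw [map_zero] at hxy; exact absurd hxy (ne p)
      | coe q =>
        obtain ⟨g, a⟩ := p
        obtain ⟨h, b⟩ := q
        induction a using Multiplicative.rec with | _ a
        induction b using Multiplicative.rec with | _ b
        rw [evalHom_coe, evalHom_coe] at hxy
        obtain ⟨rfl, hab⟩ := eval_eq Γ hΓ n hn z hz g h a b hxy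
        have h1 := conGenPair_mod Γ n a g
        rw [hab] at h1
        exact Con.trans _ h1 (Con.symm _ (conGenPair_mod Γ n b g))
  · refine Con.conGen_le.2 ?_
    rintro x y ⟨rfl, rfl⟩
    change evalHom Γ z (Tgen Γ ^ n) = evalHom Γ z (constE 1)
    rw [constE_one, map_one, Tgen_pow, evalHom_coe, hz.pow_eq_one]
    simp

theorem isGamma (Γ : Subgroup ℂˣ) (hΓ : (Γ : Set ℂˣ) = {1, -1}) (n : ℕ) (hn : Odd n) (z : ℂ)
    (hz : IsPrimitiveRoot z n) : IsGammaCon Γ (conGenPair (Tgen Γ ^ n) (constE 1)) := by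
  refine ⟨⟨ℂ, inferInstance, evalHom Γ z, ker_eq Γ hΓ n hn z hz⟩, ?_⟩
  intro g h e
  rw [← ker_eq Γ hΓ n hn z hz] at e
  have e : evalHom Γ z (constE g) = evalHom Γ z (constE h) := e
  rw [constE, constE, evalHom_coe, evalHom_coe] at e
  exact (eval_eq Γ hΓ n hn z hz g h 0 0 e).1

/-- for `Γ = {1, -1} ≤ ℂˣ`, the congruences `⟨T⁹ ~ 1⟩` and `⟨T³ ~ 1⟩` on
`Γ[T]` are `Γ`-congruences, they are distinct, and `⟨T⁹ ~ 1⟩ ≤ ⟨T³ ~ 1⟩` (so the point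
`[9,1]` lies in the closure of `[3,1]`, and the non-generic points of `P̃¹_{F_{1²}}` do
not form a T1 space). -/
theorem T9_le_T3_F12 (Γ : Subgroup ℂˣ) (hΓ : (Γ : Set ℂˣ) = {1, -1}) :
    IsGammaCon Γ (conGenPair (Tgen Γ ^ 9) (constE 1)) ∧
    IsGammaCon Γ (conGenPair (Tgen Γ ^ 3) (constE 1)) ∧
    conGenPair (Tgen Γ ^ 9) (constE 1) ≠ conGenPair (Tgen Γ ^ 3) (constE 1) ∧
    conGenPair (Tgen Γ ^ 9) (constE 1) ≤ conGenPair (Tgen Γ ^ 3) (constE 1) := by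
  have z9 := Complex.isPrimitiveRoot_exp 9 (by norm_num)
  have z3 := Complex.isPrimitiveRoot_exp 3 (by norm_num)
  have o9 : Odd 9 := by decide
  have o3 : Odd 3 := by decide
  refine ⟨isGamma Γ hΓ 9 o9 _ z9, isGamma Γ hΓ 3 o3 _ z3, ?_, ?_⟩
  · intro e
    have h : conGenPair (Tgen Γ ^ 3) (constE 1) (Tgen Γ ^ 3) (constE 1) :=
      ConGen.Rel.of _ _ ⟨rfl, rfl⟩
    rw [← e, ← ker_eq Γ hΓ 9 o9 _ z9] at h
    have h : evalHom Γ _ (Tgen Γ ^ 3) = evalHom Γ _ (constE 1) := h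
    rw [Tgen_pow, constE, evalHom_coe, evalHom_coe] at h
    have := (eval_eq Γ hΓ 9 o9 _ z9 _ _ _ _ h).2
    norm_num at this
  · refine Con.conGen_le.2 ?_
    rintro x y ⟨rfl, rfl⟩
    rw [constE_one]
    exact conGenPair_pow (Tgen Γ) 3 3
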